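/- Let k ≥ 2 and let P ⊆ [0,1]^2 be a point set with |P| = k such that every point p = (p_1,p_2) ∈ P satisfies p_1 p_2 ≥ 1 − 1/k. Then the L∞ star discrepancy of P is given by the largest anchored box containing no point of P: d*∞(P) = sup{ λ(q) : q ∈ [0,1]^2, P ∩ [0,q) = ∅ }. -/

import Mathlib

open scoped Classical

noncomputable section

/-- The volume (Lebesgue measure) of the anchored box `[0, q)` (equivalently `[0,q]`). -/
def vol {d : ℕ} (q : Fin d → ℝ) : ℝ := ∏ j, q j

/-- `x` lies in the open anchored box `[0, q) = ∏_j [0, q_j)`. -/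
def inOpenBox {d : ℕ} (q x : Fin d → ℝ) : Prop := ∀ j, 0 ≤ x j ∧ x j < q j

/-- `x` lies in the closed anchored box `[0, q] = ∏_j [0, q_j]`. -/
def inClosedBox {d : ℕ} (q x : Fin d → ℝ) : Prop := ∀ j, 0 ≤ x j ∧ x j ≤ q j

/-- `δ(q, P) = λ(q) - D(q, P) / |P|`, using the open box `[0, q)`. -/
def delta {d : ℕ} (q : Fin d → ℝ) (P : Finset (Fin d → ℝ)) : ℝ :=
  vol q - ((P.filter (fun x => inOpenBox q x)).card : ℝ) / (P.card : ℝ)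

/-- `δ̄(q, P) = D̄(q, P) / |P| - λ(q)`, using the closed box `[0, q]`. -/
def deltaBar {d : ℕ} (q : Fin d → ℝ) (P : Finset (Fin d → ℝ)) : ℝ :=
  ((P.filter (fun x => inClosedBox q x)).card : ℝ) / (P.card : ℝ) - vol q

/-- The `L∞` star discrepancy `d*∞(P) = sup_{q ∈ [0,1]^d} max (δ(q,P)) (δ̄(q,P))`. -/
def starDisc {d : ℕ} (P : Finset (Fin d → ℝ)) : ℝ :=
  sSup {x : ℝ | ∃ q : Fin d → ℝ,
    (∀ j, 0 ≤ q j ∧ q j ≤ 1) ∧ x = max (delta q P) (deltaBar q P)}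

theorem vol_fin_two (q : Fin 2 → ℝ) : vol q = q 0 * q 1 := by
  simp [vol, Fin.prod_univ_two]

theorem vol_nonneg {d : ℕ} {q : Fin d → ℝ} (hq : ∀ j, 0 ≤ q j ∧ q j ≤ 1) : 0 ≤ vol q :=
  Finset.prod_nonneg fun j _ => (hq j).1

theorem vol_le_one {d : ℕ} {q : Fin d → ℝ} (hq : ∀ j, 0 ≤ q j ∧ q j ≤ 1) : vol q ≤ 1 :=
  Finset.prod_le_one (fun j _ => (hq j).1) fun j _ => (hq j).2

theorem vol_mono {d : ℕ} {p q : Fin d → ℝ} (h : inClosedBox q p) : vol p ≤ vol q :=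
  Finset.prod_le_prod (fun j _ => (h j).1) fun j _ => (h j).2

theorem delta_eq_vol {d : ℕ} {q : Fin d → ℝ} {P : Finset (Fin d → ℝ)}
    (h : ∀ p ∈ P, ¬ inOpenBox q p) : delta q P = vol q := by
  simp [delta, Finset.filter_false_of_mem h]

/-- A box in the unit cube whose open version contains a point has `δ` at most `1 - 1/|P|`. -/
theorem delta_le_of_mem {d : ℕ} {p q : Fin d → ℝ} {P : Finset (Fin d → ℝ)}
    (hq : ∀ j, 0 ≤ q j ∧ q j ≤ 1) (hp : p ∈ P) (hpq : inOpenBox q p) :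
    delta q P ≤ 1 - 1 / (P.card : ℝ) := by
  have hcount : (1 : ℝ) ≤ ((P.filter (fun x => inOpenBox q x)).card : ℝ) := by
    exact_mod_cast Finset.card_pos.mpr ⟨p, Finset.mem_filter.mpr ⟨hp, hpq⟩⟩
  exact sub_le_sub (vol_le_one hq) (by gcongr)

theorem deltaBar_le_one_sub_vol {d : ℕ} (q : Fin d → ℝ) (P : Finset (Fin d → ℝ)) :
    deltaBar q P ≤ 1 - vol q := by
  refine sub_le_sub_right (div_le_one_of_le₀ ?_ (Nat.cast_nonneg _)) _
  exact_mod_cast Finset.card_filter_le _ _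

theorem deltaBar_nonpos {d : ℕ} {q : Fin d → ℝ} {P : Finset (Fin d → ℝ)}
    (hq : ∀ j, 0 ≤ q j ∧ q j ≤ 1) (h : ∀ p ∈ P, ¬ inClosedBox q p) : deltaBar q P ≤ 0 := by
  simpa [deltaBar, Finset.filter_false_of_mem h] using vol_nonneg hq

/-- If all `k ≥ 2` points of `P ⊆ [0,1]^2` lie above the hyperbola `xy = 1 - 1/k`, then
the star discrepancy of `P` equals the volume of the largest anchored box containing
no point of `P`. -/
theorem starDisc_eq_largest_empty_box (k : ℕ) (hk : 2 ≤ k)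
    (P : Finset (Fin 2 → ℝ)) (hcard : P.card = k)
    (hcube : ∀ p ∈ P, ∀ j, 0 ≤ p j ∧ p j ≤ 1)
    (hhyp : ∀ p ∈ P, 1 - 1 / (k : ℝ) ≤ p 0 * p 1) :
    starDisc P =
      sSup {x : ℝ | ∃ q : Fin 2 → ℝ, (∀ j, 0 ≤ q j ∧ q j ≤ 1) ∧
        (∀ p ∈ P, ¬ inOpenBox q p) ∧ x = vol q} := by
  have hk' : 1 / (k : ℝ) ≤ 1 / 2 := by
    have : (2 : ℝ) ≤ k := by exact_mod_cast hk
    gcongr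
  have hk0 : 0 ≤ 1 / (k : ℝ) := by positivity
  set M := sSup {x : ℝ | ∃ q : Fin 2 → ℝ, (∀ j, 0 ≤ q j ∧ q j ≤ 1) ∧
    (∀ p ∈ P, ¬ inOpenBox q p) ∧ x = vol q}
  have hempty : ∀ q : Fin 2 → ℝ, (∀ j, 0 ≤ q j ∧ q j ≤ 1) →
      (∀ p ∈ P, ¬ inOpenBox q p) → vol q ≤ M := by
    intro q hq hqP
    refine le_csSup ⟨1, ?_⟩ ⟨q, hq, hqP, rfl⟩
    rintro _ ⟨r, hr, -, rfl⟩
    exact vol_le_one hr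
  have hbase_cube : ∀ j, 0 ≤ (![1, 1 - 1 / (k : ℝ)] : Fin 2 → ℝ) j ∧
      (![1, 1 - 1 / (k : ℝ)] : Fin 2 → ℝ) j ≤ 1 := by
    refine Fin.forall_fin_two.mpr ⟨by simp, ?_⟩
    change 0 ≤ 1 - 1 / (k : ℝ) ∧ 1 - 1 / (k : ℝ) ≤ 1
    constructor <;> linarith
  have hbase_empty : ∀ p ∈ P, ¬ inOpenBox ![1, 1 - 1 / (k : ℝ)] p := by
    intro p hp hbox
    have h1 : p 1 < 1 - 1 / (k : ℝ) := (hbox 1).2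
    have h2 : p 0 * p 1 ≤ p 1 := mul_le_of_le_one_left (hcube p hp 1).1 (hcube p hp 0).2
    linarith [hhyp p hp]
  have hbase : 1 - 1 / (k : ℝ) ≤ M := by
    have h := hempty _ hbase_cube hbase_empty
    rw [vol_fin_two] at h
    simpa using h
  have hbound : ∀ q : Fin 2 → ℝ, (∀ j, 0 ≤ q j ∧ q j ≤ 1) →
      max (delta q P) (deltaBar q P) ≤ M := by
    intro q hq
    refine max_le ?_ ?_
    · by_cases h : ∀ p ∈ P, ¬ inOpenBox q p
      · exact (delta_eq_vol h).trans_le (hempty q hq h)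
      · push Not at h
        obtain ⟨p, hp, hpq⟩ := h
        have := delta_le_of_mem hq hp hpq
        rw [hcard] at this
        exact this.trans hbase
    · by_cases h : ∀ p ∈ P, ¬ inClosedBox q p
      · linarith [deltaBar_nonpos hq h]
      · push Not at h
        obtain ⟨p, hp, hpq⟩ := h
        have h1 := vol_mono hpq
        rw [vol_fin_two p] at h1
        linarith [deltaBar_le_one_sub_vol q P, hhyp p hp]
  apply le_antisymm
  · refine csSup_le ⟨_, _, hbase_cube, rfl⟩ ?_
    rintro _ ⟨q, hq, rfl⟩
    exact hbound q hq
  · refine csSup_le ⟨_, _, hbase_cube, hbase_empty, rfl⟩ ?_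
    rintro _ ⟨q, hq, hqP, rfl⟩
    rw [← delta_eq_vol hqP]
    refine (le_max_left _ (deltaBar q P)).trans (le_csSup ⟨M, ?_⟩ ⟨q, hq, rfl⟩)
    rintro _ ⟨r, hr, rfl⟩
    exact hbound r hr
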